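/- Let H ∈ H²(Ω) ∩ H₀¹(Ω) with ‖H‖_{L³} ≤ K, and let E ∈ H¹ with ‖E‖_{L⁶} ≤ A. Then ∫ E |curl H|² dx ≤ C K (‖∇E‖_{L²} ‖∇H‖_{L⁶} + A ‖∇²H‖_{L²}), and consequently for every η > 0, ∫ E |curl H|² dx ≤ η ‖∇E‖_{L²}² + C(η, K)(A² + ‖∇H‖_{H¹}²). -/

import Mathlib

open MeasureTheory Real Set
noncomputable section
abbrev E3 : Type := EuclideanSpace ℝ (Fin 3)
def e3 (i : Fin 3) : E3 := EuclideanSpace.single i 1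
def pdS (i : Fin 3) (f : E3 → ℝ) (x : E3) : ℝ := fderiv ℝ f x (e3 i)
def curl3 (V : E3 → Fin 3 → ℝ) (x : E3) : Fin 3 → ℝ :=
  ![pdS 1 (fun y => V y 2) x - pdS 2 (fun y => V y 1) x,
    pdS 2 (fun y => V y 0) x - pdS 0 (fun y => V y 2) x,
    pdS 0 (fun y => V y 1) x - pdS 1 (fun y => V y 0) x]
/-- Ω is either all of ℝ³ or a bounded smooth domain. -/
def SmoothDomain (Ω : Set E3) : Prop :=
  Ω = Set.univ ∨ (IsOpen Ω ∧ Bornology.IsBounded Ω ∧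
    ∃ f : E3 → ℝ, ContDiff ℝ (⊤ : ℕ∞) f ∧ Ω = {x | f x < 0} ∧
      ∀ x ∈ frontier Ω, fderiv ℝ f x ≠ 0)

/-- Hypotheses shared by both parts of STATEMENT 12: H ∈ H² ∩ H₀¹(Ω) with
‖H‖_{L³(Ω)} ≤ K, E ∈ H¹(Ω) with ‖E‖_{L⁶(Ω)} ≤ A, plus the integrability of
all the quantities involved. -/
def Hyp12 (Ω : Set E3) (K A : ℝ) (H : E3 → Fin 3 → ℝ) (Efn : E3 → ℝ) : Prop :=
  (∀ j, ContDiff ℝ 2 (fun x => H x j)) ∧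
  (∀ x ∈ frontier Ω, ∀ j, H x j = 0) ∧
  Differentiable ℝ Efn ∧
  IntegrableOn (fun x => ∑ i, (H x i)^2) Ω volume ∧
  IntegrableOn (fun x => (∑ i, (H x i)^2) ^ ((3:ℝ)/2)) Ω volume ∧
  IntegrableOn (fun x => ∑ i, ∑ j, (pdS i (fun y => H y j) x)^2) Ω volume ∧
  IntegrableOn (fun x => (∑ i, ∑ j, (pdS i (fun y => H y j) x)^2) ^ (3:ℕ)) Ω volume ∧
  IntegrableOn (fun x => ∑ k, ∑ i, ∑ j, (pdS k (pdS i (fun y => H y j)) x)^2) Ω volume ∧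
  IntegrableOn (fun x => |Efn x| ^ (6:ℕ)) Ω volume ∧
  IntegrableOn (fun x => ‖fderiv ℝ Efn x‖^2) Ω volume ∧
  IntegrableOn (fun x => Efn x * ∑ j, (curl3 H x j)^2) Ω volume ∧
  (∫ x in Ω, (∑ i, (H x i)^2) ^ ((3:ℝ)/2)) ^ ((1:ℝ)/3) ≤ K ∧
  (∫ x in Ω, |Efn x| ^ (6:ℕ)) ^ ((1:ℝ)/6) ≤ A

/-- The zeros of a real function at which its derivative does not vanish form a countable set. -/
lemma countable_setOf_eq_zero_and_deriv_ne_zero {f f' : ℝ → ℝ}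
    (hf : ∀ x, HasDerivAt f (f' x) x) : {x | f x = 0 ∧ f' x ≠ 0}.Countable := by
  have hd : IsDiscrete {x | f x = 0 ∧ f' x ≠ 0} := by
    rw [isDiscrete_iff_forall_mem_exists_isOpen]
    rintro x ⟨hx, hx'⟩
    have h := (hf x).eventually_ne (c := 0) hx'
    rw [eventually_nhdsWithin_iff] at h
    obtain ⟨V, hV, hVo, hxV⟩ := eventually_nhds_iff.1 h
    refine ⟨V, hVo, ?_⟩
    ext y
    constructor
    · rintro ⟨hyV, hy, -⟩
      by_contra hne
      exact hV y hyV hne hy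
    · rintro rfl
      exact ⟨hxV, hx, hx'⟩
  exact (HereditarilyLindelofSpace.isLindelof _).countable_of_isDiscrete hd

/-- A differentiable function that vanishes on the boundary of a bounded open set of reals has a
derivative with zero integral over this set. -/
lemma setIntegral_deriv_eq_zero_of_frontier {U : Set ℝ} (hU : IsOpen U)
    (hb : Bornology.IsBounded U) {f f' : ℝ → ℝ} (hf : ∀ x, HasDerivAt f (f' x) x)
    (h0 : ∀ x ∈ frontier U, f x = 0) (hi : IntegrableOn f' U) : ∫ x in U, f' x = 0 := by
  obtain ⟨R, hR⟩ := hb.subset_ball 0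
  set a := |R|
  have hsub : U ⊆ Ioo (-a) a := fun x hx => by
    have h1 := hR hx
    rw [Metric.mem_ball, dist_zero_right, Real.norm_eq_abs] at h1
    exact abs_lt.1 (h1.trans_le (le_abs_self R))
  have hcont : Continuous f := continuous_iff_continuousAt.2 fun x => (hf x).continuousAt
  have hgc : Continuous (U.indicator f) := continuous_indicator h0 hcont.continuousOn
  have hgd : ∀ x ∈ Ioo (-a) a \ {x | f x = 0 ∧ f' x ≠ 0},
      HasDerivAt (U.indicator f) (U.indicator f' x) x := by
    rintro x ⟨-, hx⟩
    by_cases hxU : x ∈ U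
    · rw [indicator_of_mem hxU]
      refine (hf x).congr_of_eventuallyEq ?_
      filter_upwards [hU.mem_nhds hxU] with y hy
      exact indicator_of_mem hy f
    · rw [indicator_of_notMem hxU]
      by_cases hxc : x ∈ closure U
      · have hfx : f x = 0 := h0 x ⟨hxc, by rwa [hU.interior_eq]⟩
        have hf'x : f' x = 0 := by
          by_contra h
          exact hx ⟨hfx, h⟩
        have h1 := hf x
        rw [hf'x, hasDerivAt_iff_isLittleO] at h1
        rw [hasDerivAt_iff_isLittleO]
        refine Asymptotics.IsBigO.trans_isLittleO ?_ h1
        refine Asymptotics.IsBigO.of_bound 1 (Filter.Eventually.of_forall fun y => ?_)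
        by_cases hy : y ∈ U <;> simp [hy, hxU, hfx]
      · refine (hasDerivAt_const x (0 : ℝ)).congr_of_eventuallyEq ?_
        filter_upwards [isClosed_closure.isOpen_compl.mem_nhds hxc] with y hy
        exact indicator_of_notMem (fun h => hy (subset_closure h)) f
  have key := integral_eq_of_hasDerivAt_off_countable_of_le (U.indicator f) (U.indicator f')
    (neg_le_self (abs_nonneg R)) (countable_setOf_eq_zero_and_deriv_ne_zero hf)
    hgc.continuousOn hgd (hi.integrable_indicator hU.measurableSet).intervalIntegrable
  rw [indicator_of_notMem (fun h => (hsub h).2.false),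
    indicator_of_notMem (fun h => (hsub h).1.false), sub_zero,
    intervalIntegral.integral_of_le (neg_le_self (abs_nonneg R)),
    setIntegral_indicator hU.measurableSet,
    inter_eq_right.2 (hsub.trans Ioo_subset_Ioc_self)] at key
  exact key

/-- The point of `E3` with `i`-th coordinate `t` and remaining coordinates `y`. -/
def slicePoint (i : Fin 3) (y : Fin 2 → ℝ) (t : ℝ) : E3 := WithLp.toLp 2 (i.insertNth t y)

lemma slicePoint_eq (i : Fin 3) (y : Fin 2 → ℝ) (t : ℝ) :
    slicePoint i y t = slicePoint i y 0 + t • e3 i := by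
  ext j
  refine Fin.succAboveCases i ?_ (fun k => ?_) j <;> simp [slicePoint, e3]

lemma hasDerivAt_slicePoint (i : Fin 3) (y : Fin 2 → ℝ) (t : ℝ) :
    HasDerivAt (slicePoint i y) (e3 i) t := by
  have h : slicePoint i y = fun t => slicePoint i y 0 + t • e3 i :=
    funext (slicePoint_eq i y)
  rw [h]
  simpa using ((hasDerivAt_id t).smul_const (e3 i)).const_add (slicePoint i y 0)

/-- A differentiable function that vanishes on the boundary of a bounded open set has partial
derivatives with zero integral over this set. -/
lemma setIntegral_pdS_eq_zero_of_isBounded {Ω : Set E3} (hΩ : IsOpen Ω)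
    (hb : Bornology.IsBounded Ω) (i : Fin 3) {w : E3 → ℝ} (hw : Differentiable ℝ w)
    (h0 : ∀ x ∈ frontier Ω, w x = 0) (hi : IntegrableOn (pdS i w) Ω) :
    ∫ x in Ω, pdS i w x = 0 := by
  let Φ : ℝ × (Fin 2 → ℝ) ≃ᵐ E3 :=
    (MeasurableEquiv.piFinSuccAbove (fun _ : Fin 3 => ℝ) i).symm.trans
      (MeasurableEquiv.toLp 2 (Fin 3 → ℝ))
  have hΦ : MeasurePreserving Φ volume volume :=
    (volume_preserving_piFinSuccAbove (fun _ : Fin 3 => ℝ) i).symm.trans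
      (PiLp.volume_preserving_toLp (Fin 3))
  have hΦs : ∀ p : ℝ × (Fin 2 → ℝ), Φ p = slicePoint i p.2 p.1 := fun p => rfl
  have hint : Integrable (fun p => Ω.indicator (pdS i w) (Φ p))
      ((volume : Measure ℝ).prod (volume : Measure (Fin 2 → ℝ))) :=
    (hΦ.integrable_comp_emb Φ.measurableEmbedding).2 (hi.integrable_indicator hΩ.measurableSet)
  rw [← integral_indicator hΩ.measurableSet, ← hΦ.integral_comp Φ.measurableEmbedding,
    Measure.volume_eq_prod, integral_prod_symm _ hint]
  refine integral_eq_zero_of_ae ?_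
  filter_upwards [hint.prod_left_ae] with y hy
  have hcont : Continuous (slicePoint i y) :=
    continuous_iff_continuousAt.2 fun t => (hasDerivAt_slicePoint i y t).continuousAt
  have hU : IsOpen (slicePoint i y ⁻¹' Ω) := hΩ.preimage hcont
  have heq : (fun t => Ω.indicator (pdS i w) (Φ (t, y))) =
      (slicePoint i y ⁻¹' Ω).indicator (fun t => pdS i w (slicePoint i y t)) := rfl
  rw [heq] at hy
  show ∫ t, (fun t => Ω.indicator (pdS i w) (Φ (t, y))) t = 0
  rw [heq, integral_indicator hU.measurableSet]
  refine setIntegral_deriv_eq_zero_of_frontier hU ?_ (f := fun t => w (slicePoint i y t))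
    (fun t => (hw _).hasFDerivAt.comp_hasDerivAt t (hasDerivAt_slicePoint i y t))
    (fun t ht => h0 _ (hcont.frontier_preimage_subset Ω ht))
    ((integrable_indicator_iff hU.measurableSet).1 hy)
  obtain ⟨R, hR⟩ := hb.subset_closedBall 0
  refine (Metric.isBounded_closedBall (x := (0 : ℝ)) (r := R)).subset fun t ht => ?_
  have h1 := hR ht
  rw [mem_closedBall_zero_iff] at h1 ⊢
  refine le_trans ?_ h1
  simpa [slicePoint] using PiLp.norm_apply_le (slicePoint i y t) i

/-- On a smooth domain, an integrable differentiable function that vanishes on the boundary has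
partial derivatives with zero integral. -/
lemma SmoothDomain.setIntegral_pdS_eq_zero {Ω : Set E3} (hΩ : SmoothDomain Ω) (i : Fin 3)
    {w : E3 → ℝ} (hw : Differentiable ℝ w) (h0 : ∀ x ∈ frontier Ω, w x = 0)
    (hwi : IntegrableOn w Ω) (hi : IntegrableOn (pdS i w) Ω) : ∫ x in Ω, pdS i w x = 0 := by
  rcases hΩ with rfl | ⟨ho, hb, -⟩
  · rw [integrableOn_univ] at hwi hi
    have h := integral_mul_fderiv_eq_neg_fderiv_mul_of_integrable (μ := (volume : Measure E3))
      (f := fun _ : E3 => (1 : ℝ)) (g := w) (v := e3 i) (by simp)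
      (by simpa [pdS] using! hi) (by simpa using hwi) (by simp) (fun x _ => hw x)
    simpa [pdS] using h
  · exact setIntegral_pdS_eq_zero_of_isBounded ho hb i hw h0 hi

lemma hasDerivAt_abs_rpow_mul_self {a : ℝ} (ha : 0 < a) (s : ℝ) :
    HasDerivAt (fun s : ℝ => |s| ^ a * s) ((a + 1) * |s| ^ a) s := by
  rcases eq_or_ne s 0 with rfl | hs
  · have h : Filter.Tendsto (fun s : ℝ => |s| ^ a) (nhdsWithin 0 {0}ᶜ) (nhds 0) := by
      have hc : Continuous fun s : ℝ => |s| ^ a := continuous_abs.rpow_const fun _ => Or.inr ha.le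
      simpa [Real.zero_rpow ha.ne'] using (hc.tendsto 0).mono_left nhdsWithin_le_nhds
    rw [abs_zero, Real.zero_rpow ha.ne', mul_zero, hasDerivAt_iff_tendsto_slope]
    refine h.congr' ?_
    filter_upwards [self_mem_nhdsWithin] with x hx
    have hx' : x ≠ 0 := hx
    simp only [slope, sub_zero, vsub_eq_sub, abs_zero, smul_eq_mul, mul_zero]
    field_simp
  · have h := ((hasDerivAt_abs hs).rpow_const (p := a) (Or.inl (abs_ne_zero.2 hs))).mul
      (hasDerivAt_id s)
    refine h.congr_deriv ?_
    have h1 : |s| ^ (a - 1) * |s| = |s| ^ a := by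
      rw [← Real.rpow_add_one (abs_ne_zero.2 hs), sub_add_cancel]
    have h2 : (SignType.sign s : ℝ) * s = |s| := sign_mul_self s
    simp only [id]
    rw [← h1, ← h2]
    ring

/-- Hölder's inequality for three functions, with the integrability of the product. -/
lemma integral_rpow_mul_rpow_mul_rpow_le {α : Type*} [MeasurableSpace α] {μ : Measure α}
    {a b c : α → ℝ} {p q r : ℝ} (ha : Integrable a μ) (hb : Integrable b μ) (hc : Integrable c μ)
    (ha0 : ∀ x, 0 ≤ a x) (hb0 : ∀ x, 0 ≤ b x) (hc0 : ∀ x, 0 ≤ c x)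
    (hp : 0 ≤ p) (hq : 0 ≤ q) (hr : 0 ≤ r) (hpqr : p + q + r = 1) :
    Integrable (fun x => a x ^ p * b x ^ q * c x ^ r) μ ∧
      ∫ x, a x ^ p * b x ^ q * c x ^ r ∂μ ≤
        (∫ x, a x ∂μ) ^ p * (∫ x, b x ∂μ) ^ q * (∫ x, c x ∂μ) ^ r := by
  have hm : AEStronglyMeasurable (fun x => a x ^ p * b x ^ q * c x ^ r) μ :=
    (((ha.aemeasurable.pow_const p).mul (hb.aemeasurable.pow_const q)).mul
      (hc.aemeasurable.pow_const r)).aestronglyMeasurable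
  have h0 : ∀ x, 0 ≤ a x ^ p * b x ^ q * c x ^ r := fun x =>
    mul_nonneg (mul_nonneg (rpow_nonneg (ha0 x) _) (rpow_nonneg (hb0 x) _))
      (rpow_nonneg (hc0 x) _)
  refine ⟨(((ha.const_mul p).add (hb.const_mul q)).add (hc.const_mul r)).mono' hm
    (Filter.Eventually.of_forall fun x => ?_), ?_⟩
  · rw [Real.norm_of_nonneg (h0 x)]
    exact geom_mean_le_arith_mean3_weighted hp hq hr (ha0 x) (hb0 x) (hc0 x) hpqr
  · rw [integral_eq_lintegral_of_nonneg_ae (Filter.Eventually.of_forall h0) hm]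
    have hA : 0 ≤ ∫ x, a x ∂μ := integral_nonneg ha0
    have hB : 0 ≤ ∫ x, b x ∂μ := integral_nonneg hb0
    have hC : 0 ≤ ∫ x, c x ∂μ := integral_nonneg hc0
    refine ENNReal.toReal_le_of_le_ofReal (by positivity) ?_
    have key := ENNReal.lintegral_prod_norm_pow_le (μ := μ) (Finset.univ : Finset (Fin 3))
      (f := ![fun x => ENNReal.ofReal (a x), fun x => ENNReal.ofReal (b x),
        fun x => ENNReal.ofReal (c x)]) (p := ![p, q, r])
      (by
        intro i _
        fin_cases i
        exacts [ha.aemeasurable.ennreal_ofReal, hb.aemeasurable.ennreal_ofReal,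
          hc.aemeasurable.ennreal_ofReal])
      (by simpa [Fin.sum_univ_three] using hpqr)
      (by
        intro i _
        fin_cases i
        exacts [hp, hq, hr])
    simp only [Fin.prod_univ_three, Matrix.cons_val] at key
    rw [← ofReal_integral_eq_lintegral_ofReal ha (Filter.Eventually.of_forall ha0),
      ← ofReal_integral_eq_lintegral_ofReal hb (Filter.Eventually.of_forall hb0),
      ← ofReal_integral_eq_lintegral_ofReal hc (Filter.Eventually.of_forall hc0),
      ENNReal.ofReal_rpow_of_nonneg hA hp, ENNReal.ofReal_rpow_of_nonneg hB hq,
      ENNReal.ofReal_rpow_of_nonneg hC hr, ← ENNReal.ofReal_mul (by positivity),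
      ← ENNReal.ofReal_mul (by positivity)] at key
    refine le_trans (le_of_eq (lintegral_congr fun x => ?_)) key
    rw [ENNReal.ofReal_rpow_of_nonneg (ha0 x) hp, ENNReal.ofReal_rpow_of_nonneg (hb0 x) hq,
      ENNReal.ofReal_rpow_of_nonneg (hc0 x) hr,
      ← ENNReal.ofReal_mul (rpow_nonneg (ha0 x) _),
      ← ENNReal.ofReal_mul (mul_nonneg (rpow_nonneg (ha0 x) _) (rpow_nonneg (hb0 x) _))]

lemma contDiff_pdS {g : E3 → ℝ} (hg : ContDiff ℝ 2 g) (i : Fin 3) : ContDiff ℝ 1 (pdS i g) :=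
  (hg.fderiv_right (m := 1) (by norm_num)).clm_apply contDiff_const

lemma measurable_pdS (i : Fin 3) (g : E3 → ℝ) : Measurable (pdS i g) :=
  measurable_fderiv_apply_const ℝ g (e3 i)

lemma abs_pow_rpow_inv (s : ℝ) {n : ℕ} (hn : n ≠ 0) : (|s| ^ n) ^ ((1 : ℝ) / n) = |s| := by
  rw [one_div, Real.pow_rpow_inv_natCast (abs_nonneg s) hn]

lemma abs_rpow_mul_sq (s : ℝ) : |s| ^ ((2 : ℝ) / 5) * s * s = |s| ^ ((12 : ℝ) / 5) := by
  rw [mul_assoc, ← abs_mul_abs_self s, ← pow_two, ← Real.rpow_natCast |s| 2,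
    ← Real.rpow_add' (abs_nonneg s) (by norm_num)]
  norm_num

lemma abs_rpow_le_sq_add_pow_six (s : ℝ) : |s| ^ ((12 : ℝ) / 5) ≤ s ^ 2 + s ^ 6 := by
  have h2 : |s| ^ (2 : ℝ) = s ^ 2 := by
    rw [show (2 : ℝ) = ((2 : ℕ) : ℝ) by norm_num, Real.rpow_natCast, sq_abs]
  have h6 : |s| ^ (6 : ℝ) = s ^ 6 := by
    rw [show (6 : ℝ) = ((6 : ℕ) : ℝ) by norm_num, Real.rpow_natCast,
      Even.pow_abs (by decide)]
  rcases eq_or_ne s 0 with rfl | hs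
  · simp
  rcases le_total |s| 1 with h | h
  · have := Real.rpow_le_rpow_of_exponent_ge (abs_pos.2 hs) h
      (show (2 : ℝ) ≤ 12 / 5 by norm_num)
    rw [h2] at this
    have : 0 ≤ s ^ 6 := by positivity
    linarith
  · have := Real.rpow_le_rpow_of_exponent_le h (show (12 / 5 : ℝ) ≤ 6 by norm_num)
    rw [h6] at this
    have : 0 ≤ s ^ 2 := by positivity
    linarith

/-- A Gagliardo–Nirenberg inequality `‖∂ᵢg‖²_{L^{12/5}} ≤ (7/5) ‖g‖_{L³} ‖∂ᵢ²g‖_{L²}` for functions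
vanishing on the boundary. -/
lemma SmoothDomain.gagliardo_nirenberg {Ω : Set E3} (hΩ : SmoothDomain Ω) (i : Fin 3) {g : E3 → ℝ}
    (hg : ContDiff ℝ 2 g) (h0 : ∀ x ∈ frontier Ω, g x = 0)
    (hg3 : IntegrableOn (fun x => |g x| ^ 3) Ω)
    (hD2 : IntegrableOn (fun x => pdS i g x ^ 2) Ω)
    (hD6 : IntegrableOn (fun x => pdS i g x ^ 6) Ω)
    (hDD : IntegrableOn (fun x => pdS i (pdS i g) x ^ 2) Ω) :
    IntegrableOn (fun x => |pdS i g x| ^ ((12 : ℝ) / 5)) Ω ∧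
      (∫ x in Ω, |pdS i g x| ^ ((12 : ℝ) / 5)) ^ ((5 : ℝ) / 6) ≤
        7 / 5 * ((∫ x in Ω, |g x| ^ 3) ^ ((1 : ℝ) / 3) *
          (∫ x in Ω, pdS i (pdS i g) x ^ 2) ^ ((1 : ℝ) / 2)) := by
  set D := pdS i g
  set D' := pdS i D
  have hDc : ContDiff ℝ 1 D := contDiff_pdS hg i
  have hDm : Measurable D := measurable_pdS i g
  have hD'm : Measurable D' := measurable_pdS i D
  have hgm : Measurable g := hg.continuous.measurable
  have hJ : IntegrableOn (fun x => |D x| ^ ((12 : ℝ) / 5)) Ω := by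
    refine Integrable.mono' (hD2.add hD6) (hDm.abs.pow_const _).aestronglyMeasurable
      (Filter.Eventually.of_forall fun x => ?_)
    rw [Real.norm_of_nonneg (by positivity)]
    exact abs_rpow_le_sq_add_pow_six (D x)
  refine ⟨hJ, ?_⟩
  have hr3 : ∀ s : ℝ, (|s| ^ 3) ^ ((1 : ℝ) / 3) = |s| := fun s => by
    simpa using abs_pow_rpow_inv s (n := 3) (by norm_num)
  have hr2 : ∀ s : ℝ, (s ^ 2) ^ ((1 : ℝ) / 2) = |s| := fun s => by
    simpa using abs_pow_rpow_inv s (n := 2) (by norm_num)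
  have hrJ : ∀ s : ℝ, (|s| ^ ((12 : ℝ) / 5)) ^ ((1 : ℝ) / 6) = |s| ^ ((2 : ℝ) / 5) := fun s => by
    rw [← Real.rpow_mul (abs_nonneg s)]
    norm_num
  have holder := fun (c : E3 → ℝ) (hc : IntegrableOn (fun x => c x ^ 2) Ω volume) =>
    integral_rpow_mul_rpow_mul_rpow_le (p := 1 / 3) (q := 1 / 6) (r := 1 / 2) hg3 hJ hc
      (fun x => by positivity) (fun x => by positivity) (fun x => by positivity)
      (by norm_num) (by norm_num) (by norm_num) (by norm_num)
  simp only [hr3, hr2, hrJ] at holder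
  have hφ : Differentiable ℝ fun x => |D x| ^ ((2 : ℝ) / 5) * D x := fun x =>
    ((hasDerivAt_abs_rpow_mul_self (by norm_num) (D x)).comp_hasFDerivAt x
      (hDc.differentiable (by norm_num) x).hasFDerivAt).differentiableAt
  have hgd : Differentiable ℝ g := hg.differentiable (by norm_num)
  have hder : ∀ x, pdS i (fun x => |D x| ^ ((2 : ℝ) / 5) * D x * g x) x =
      |D x| ^ ((12 : ℝ) / 5) + 7 / 5 * (|D x| ^ ((2 : ℝ) / 5) * D' x * g x) := fun x => by
    have h := ((hasDerivAt_abs_rpow_mul_self (a := 2 / 5) (by norm_num) (D x)).comp_hasFDerivAt x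
      (hDc.differentiable (by norm_num) x).hasFDerivAt).mul (hgd x).hasFDerivAt
    have h' : pdS i (fun x => |D x| ^ ((2 : ℝ) / 5) * D x * g x) x = _ :=
      congrArg (fun L : E3 →L[ℝ] ℝ => L (e3 i)) h.fderiv
    rw [h', ← abs_rpow_mul_sq (D x)]
    have e1 : fderiv ℝ g x (e3 i) = D x := rfl
    have e2 : fderiv ℝ D x (e3 i) = D' x := rfl
    simp [e1, e2]
    ring
  have hi2 : IntegrableOn (fun x => |D x| ^ ((2 : ℝ) / 5) * D' x * g x) Ω := by
    refine (holder D' hDD).1.mono' (((hDm.abs.pow_const _).mul hD'm).mul hgm).aestronglyMeasurable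
      (Filter.Eventually.of_forall fun x => le_of_eq ?_)
    rw [norm_mul, norm_mul, Real.norm_of_nonneg (rpow_nonneg (abs_nonneg _) _),
      Real.norm_eq_abs, Real.norm_eq_abs]
    ring
  have hi1 : IntegrableOn (fun x => |D x| ^ ((2 : ℝ) / 5) * D x * g x) Ω := by
    refine (holder D hD2).1.mono' (((hDm.abs.pow_const _).mul hDm).mul hgm).aestronglyMeasurable
      (Filter.Eventually.of_forall fun x => le_of_eq ?_)
    rw [norm_mul, norm_mul, Real.norm_of_nonneg (rpow_nonneg (abs_nonneg _) _),
      Real.norm_eq_abs, Real.norm_eq_abs]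
    ring
  have hzero := hΩ.setIntegral_pdS_eq_zero i (hφ.mul hgd)
    (fun x hx => by simp [h0 x hx]) hi1
    ((hJ.add (hi2.const_mul (7 / 5))).congr (Filter.Eventually.of_forall fun x => (hder x).symm))
  have hzero' : ∫ x in Ω, (|D x| ^ ((12 : ℝ) / 5) +
      7 / 5 * (|D x| ^ ((2 : ℝ) / 5) * D' x * g x)) = 0 := by
    rw [← hzero]
    exact integral_congr_ae (Filter.Eventually.of_forall fun x => (hder x).symm)
  rw [integral_add hJ (hi2.const_mul _), integral_const_mul] at hzero'
  have hbound : -∫ x in Ω, |D x| ^ ((2 : ℝ) / 5) * D' x * g x ≤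
      ∫ x in Ω, |g x| * |D x| ^ ((2 : ℝ) / 5) * |D' x| := by
    rw [← integral_neg]
    refine integral_mono hi2.neg (holder D' hDD).1 fun x => ?_
    refine (neg_le_abs _).trans (le_of_eq ?_)
    rw [abs_mul, abs_mul, abs_of_nonneg (rpow_nonneg (abs_nonneg (D x)) _)]
    ring
  have hh := (holder D' hDD).2
  have hJ0 : 0 ≤ ∫ x in Ω, |D x| ^ ((12 : ℝ) / 5) := integral_nonneg fun x => by positivity
  have hG0 : 0 ≤ ∫ x in Ω, |g x| ^ 3 := integral_nonneg fun x => by positivity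
  have hQ0 : 0 ≤ ∫ x in Ω, D' x ^ 2 := integral_nonneg fun x => by positivity
  set J := ∫ x in Ω, |D x| ^ ((12 : ℝ) / 5)
  rcases hJ0.eq_or_lt with hJ0 | hJ0
  · rw [← hJ0, Real.zero_rpow (by norm_num)]
    positivity
  · have hJ6 : 0 < J ^ ((1 : ℝ) / 6) := by positivity
    have hsplit : J ^ ((1 : ℝ) / 6) * J ^ ((5 : ℝ) / 6) = J := by
      rw [← Real.rpow_add hJ0]
      norm_num
    refine le_of_mul_le_mul_left ?_ hJ6
    rw [hsplit]
    linarith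

/-- `∫ |E| (∂ᵢg)² ≤ (7/5) ‖E‖_{L⁶} ‖g‖_{L³} ‖∂ᵢ²g‖_{L²}` for `g` vanishing on the boundary. -/
lemma SmoothDomain.integral_abs_mul_pdS_sq_le {Ω : Set E3} (hΩ : SmoothDomain Ω) (i : Fin 3)
    {g E : E3 → ℝ}
    (hg : ContDiff ℝ 2 g) (h0 : ∀ x ∈ frontier Ω, g x = 0)
    (hE : IntegrableOn (fun x => |E x| ^ 6) Ω)
    (hg3 : IntegrableOn (fun x => |g x| ^ 3) Ω)
    (hD2 : IntegrableOn (fun x => pdS i g x ^ 2) Ω)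
    (hD6 : IntegrableOn (fun x => pdS i g x ^ 6) Ω)
    (hDD : IntegrableOn (fun x => pdS i (pdS i g) x ^ 2) Ω) :
    IntegrableOn (fun x => |E x| * pdS i g x ^ 2) Ω ∧
      ∫ x in Ω, |E x| * pdS i g x ^ 2 ≤ (∫ x in Ω, |E x| ^ 6) ^ ((1 : ℝ) / 6) *
        (7 / 5 * ((∫ x in Ω, |g x| ^ 3) ^ ((1 : ℝ) / 3) *
          (∫ x in Ω, pdS i (pdS i g) x ^ 2) ^ ((1 : ℝ) / 2))) := by
  obtain ⟨hJ, hGN⟩ := hΩ.gagliardo_nirenberg i hg h0 hg3 hD2 hD6 hDD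
  have hr6 : ∀ s : ℝ, (|s| ^ 6) ^ ((1 : ℝ) / 6) = |s| := fun s => by
    simpa using abs_pow_rpow_inv s (n := 6) (by norm_num)
  have hrJ : ∀ s : ℝ, (|s| ^ ((12 : ℝ) / 5)) ^ ((5 : ℝ) / 12) = |s| := fun s => by
    rw [← Real.rpow_mul (abs_nonneg s)]
    norm_num
  have holder := integral_rpow_mul_rpow_mul_rpow_le (p := 1 / 6) (q := 5 / 12) (r := 5 / 12)
      hE hJ hJ
      (fun x => by positivity) (fun x => by positivity) (fun x => by positivity)
      (by norm_num) (by norm_num) (by norm_num) (by norm_num)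
  simp only [hr6, hrJ, mul_assoc, abs_mul_abs_self] at holder
  have hJ0 : 0 ≤ ∫ x in Ω, |pdS i g x| ^ ((12 : ℝ) / 5) := integral_nonneg fun x => by positivity
  rw [← Real.rpow_add' hJ0 (by norm_num), show (5 / 12 + 5 / 12 : ℝ) = 5 / 6 by norm_num] at holder
  simp only [← pow_two] at holder
  refine ⟨holder.1, holder.2.trans (mul_le_mul_of_nonneg_left hGN ?_)⟩
  exact rpow_nonneg (integral_nonneg fun x => by positivity) _

lemma sum_curl3_sq_le (V : E3 → Fin 3 → ℝ) (x : E3) :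
    ∑ j, curl3 V x j ^ 2 ≤ 2 * ∑ i, ∑ j, pdS i (fun y => V y j) x ^ 2 := by
  simp only [curl3, Fin.sum_univ_three, Matrix.cons_val]
  nlinarith [sq_nonneg (pdS 1 (fun y => V y 2) x + pdS 2 (fun y => V y 1) x),
    sq_nonneg (pdS 2 (fun y => V y 0) x + pdS 0 (fun y => V y 2) x),
    sq_nonneg (pdS 0 (fun y => V y 1) x + pdS 1 (fun y => V y 0) x),
    sq_nonneg (pdS 0 (fun y => V y 0) x), sq_nonneg (pdS 1 (fun y => V y 1) x),
    sq_nonneg (pdS 2 (fun y => V y 2) x)]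

lemma sq_le_sum_sum_sq (a : Fin 3 → Fin 3 → ℝ) (i j : Fin 3) : a i j ^ 2 ≤ ∑ i, ∑ j, a i j ^ 2 :=
  (Finset.single_le_sum (f := fun j => a i j ^ 2) (fun _ _ => sq_nonneg _)
    (Finset.mem_univ j)).trans
    (Finset.single_le_sum (f := fun i => ∑ j, a i j ^ 2)
      (fun _ _ => Finset.sum_nonneg fun _ _ => sq_nonneg _) (Finset.mem_univ i))

/-- The curl estimate without any contribution of the gradient of `E`. -/
lemma Hyp12.integral_mul_curl_sq_le {Ω : Set E3} (hΩ : SmoothDomain Ω) {K A : ℝ}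
    {H : E3 → Fin 3 → ℝ} {E : E3 → ℝ} (hK : 0 ≤ K) (hA : 0 ≤ A) (h : Hyp12 Ω K A H E) :
    ∫ x in Ω, E x * ∑ j, (curl3 H x j) ^ 2 ≤
      126 / 5 * K * (A * (∫ x in Ω, ∑ k, ∑ i, ∑ j,
        (pdS k (pdS i (fun y => H y j)) x) ^ 2) ^ ((1 : ℝ) / 2)) := by
  obtain ⟨hH, h0, -, -, hH3, hD2, hD6, hDD, hE6, -, hcurl, hKH, hAE⟩ := h
  set Q := ∫ x in Ω, ∑ k, ∑ i, ∑ j, (pdS k (pdS i (fun y => H y j)) x) ^ 2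
  have hcomp3 : ∀ j x, |H x j| ^ 3 ≤ (∑ i, (H x i) ^ 2) ^ ((3 : ℝ) / 2) := fun j x => by
    have h1 : |H x j| ^ 3 = ((H x j) ^ 2) ^ ((3 : ℝ) / 2) := by
      rw [← sq_abs, ← Real.rpow_natCast |H x j| 2, ← Real.rpow_mul (abs_nonneg _),
        ← Real.rpow_natCast |H x j| 3]
      norm_num
    rw [h1]
    exact Real.rpow_le_rpow (sq_nonneg _) (Finset.single_le_sum (f := fun i => H x i ^ 2)
      (fun _ _ => sq_nonneg _) (Finset.mem_univ j)) (by norm_num)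
  have hcompQ : ∀ i j x, pdS i (pdS i fun y => H y j) x ^ 2 ≤
      ∑ k, ∑ i, ∑ j, (pdS k (pdS i (fun y => H y j)) x) ^ 2 := fun i j x =>
    (sq_le_sum_sum_sq (fun i' j' => pdS i (pdS i' fun y => H y j') x) i j).trans
      (Finset.single_le_sum (f := fun k => ∑ i, ∑ j, (pdS k (pdS i (fun y => H y j)) x) ^ 2)
        (fun _ _ => by positivity) (Finset.mem_univ i))
  have hiH : ∀ j, IntegrableOn (fun x => |H x j| ^ 3) Ω := fun j =>
    hH3.mono' ((hH j).continuous.measurable.abs.pow_const 3).aestronglyMeasurable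
      (Filter.Eventually.of_forall fun x => by
        rw [Real.norm_of_nonneg (by positivity)]
        exact hcomp3 j x)
  have hiD2 : ∀ i j, IntegrableOn (fun x => pdS i (fun y => H y j) x ^ 2) Ω := fun i j =>
    hD2.mono' ((measurable_pdS i _).pow_const 2).aestronglyMeasurable
      (Filter.Eventually.of_forall fun x => by
        rw [Real.norm_of_nonneg (by positivity)]
        exact sq_le_sum_sum_sq (fun i j => pdS i (fun y => H y j) x) i j)
  have hiD6 : ∀ i j, IntegrableOn (fun x => pdS i (fun y => H y j) x ^ 6) Ω := fun i j =>
    hD6.mono' ((measurable_pdS i _).pow_const 6).aestronglyMeasurable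
      (Filter.Eventually.of_forall fun x => by
        rw [Real.norm_of_nonneg (by positivity), show 6 = 2 * 3 from rfl, pow_mul]
        exact pow_le_pow_left₀ (sq_nonneg _)
          (sq_le_sum_sum_sq (fun i j => pdS i (fun y => H y j) x) i j) 3)
  have hiDD : ∀ i j, IntegrableOn (fun x => pdS i (pdS i fun y => H y j) x ^ 2) Ω := fun i j =>
    hDD.mono' ((measurable_pdS i _).pow_const 2).aestronglyMeasurable
      (Filter.Eventually.of_forall fun x => by
        rw [Real.norm_of_nonneg (by positivity)]
        exact hcompQ i j x)
  have hterm := fun i j => hΩ.integral_abs_mul_pdS_sq_le i (hH j) (fun x hx => h0 x hx j) hE6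
    (hiH j) (hiD2 i j) (hiD6 i j) (hiDD i j)
  have hle : ∀ i j, ∫ x in Ω, |E x| * pdS i (fun y => H y j) x ^ 2 ≤
      A * (7 / 5 * (K * Q ^ ((1 : ℝ) / 2))) := fun i j => by
    refine (hterm i j).2.trans ?_
    have hG : (∫ x in Ω, |H x j| ^ 3) ^ ((1 : ℝ) / 3) ≤ K :=
      (Real.rpow_le_rpow (integral_nonneg fun x => by positivity)
        (integral_mono (hiH j) hH3 (hcomp3 j)) (by norm_num)).trans hKH
    have hQ' : (∫ x in Ω, pdS i (pdS i fun y => H y j) x ^ 2) ^ ((1 : ℝ) / 2) ≤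
        Q ^ ((1 : ℝ) / 2) :=
      Real.rpow_le_rpow (integral_nonneg fun x => by positivity)
        (integral_mono (hiDD i j) hDD (hcompQ i j)) (by norm_num)
    have hQ0 : 0 ≤ ∫ x in Ω, pdS i (pdS i fun y => H y j) x ^ 2 :=
      integral_nonneg fun x => by positivity
    have hG0 : 0 ≤ ∫ x in Ω, |H x j| ^ 3 := integral_nonneg fun x => by positivity
    gcongr
  have hsum : Integrable (fun x => 2 * ∑ i, ∑ j, |E x| * pdS i (fun y => H y j) x ^ 2)
      (volume.restrict Ω) :=
    (integrable_finsetSum _ fun i _ => integrable_finsetSum _ fun j _ => (hterm i j).1).const_mul 2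
  have hpt : ∀ x, E x * ∑ j, (curl3 H x j) ^ 2 ≤
      2 * ∑ i, ∑ j, |E x| * pdS i (fun y => H y j) x ^ 2 := fun x => by
    simp only [← Finset.mul_sum]
    calc E x * ∑ j, (curl3 H x j) ^ 2 ≤ |E x| * ∑ j, (curl3 H x j) ^ 2 := by
          gcongr
          exact le_abs_self _
      _ ≤ |E x| * (2 * ∑ i, ∑ j, pdS i (fun y => H y j) x ^ 2) := by
          gcongr
          exact sum_curl3_sq_le H x
      _ = _ := by ring
  calc ∫ x in Ω, E x * ∑ j, (curl3 H x j) ^ 2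
      ≤ ∫ x in Ω, 2 * ∑ i, ∑ j, |E x| * pdS i (fun y => H y j) x ^ 2 :=
        integral_mono hcurl hsum hpt
    _ = 2 * ∑ i, ∑ j, ∫ x in Ω, |E x| * pdS i (fun y => H y j) x ^ 2 := by
        rw [integral_const_mul, integral_finsetSum _ fun i _ =>
          integrable_finsetSum _ fun j _ => (hterm i j).1]
        simp_rw [integral_finsetSum _ fun j _ => (hterm _ j).1]
    _ ≤ 2 * ∑ _i : Fin 3, ∑ _j : Fin 3, A * (7 / 5 * (K * Q ^ ((1 : ℝ) / 2))) := by
        gcongr with i _ j _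
        exact hle i j
    _ = 126 / 5 * K * (A * Q ^ ((1 : ℝ) / 2)) := by
        simp
        ring

/-- ∫ E|curl H|² ≤ CK(‖∇E‖₂‖∇H‖₆ + A‖∇²H‖₂), and for every η > 0,
∫ E|curl H|² ≤ η‖∇E‖₂² + C(η,K)(A² + ‖∇H‖_{H¹}²). -/
theorem stmt_12 (Ω : Set E3) (hΩ : SmoothDomain Ω) :
    (∃ C > 0, ∀ (K A : ℝ) (H : E3 → Fin 3 → ℝ) (Efn : E3 → ℝ),
      0 ≤ K → 0 ≤ A → Hyp12 Ω K A H Efn →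
      ∫ x in Ω, Efn x * ∑ j, (curl3 H x j)^2
        ≤ C * K * ((∫ x in Ω, ‖fderiv ℝ Efn x‖^2) ^ ((1:ℝ)/2)
              * (∫ x in Ω, (∑ i, ∑ j, (pdS i (fun y => H y j) x)^2) ^ (3:ℕ)) ^ ((1:ℝ)/6)
            + A * (∫ x in Ω, ∑ k, ∑ i, ∑ j,
                (pdS k (pdS i (fun y => H y j)) x)^2) ^ ((1:ℝ)/2)))
    ∧ ∀ η : ℝ, 0 < η → ∀ K : ℝ, 0 ≤ K →
      ∃ C > 0, ∀ (A : ℝ) (H : E3 → Fin 3 → ℝ) (Efn : E3 → ℝ),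
      0 ≤ A → Hyp12 Ω K A H Efn →
      ∫ x in Ω, Efn x * ∑ j, (curl3 H x j)^2
        ≤ η * (∫ x in Ω, ‖fderiv ℝ Efn x‖^2)
          + C * (A^2 + (∫ x in Ω, ∑ i, ∑ j, (pdS i (fun y => H y j) x)^2)
            + (∫ x in Ω, ∑ k, ∑ i, ∑ j, (pdS k (pdS i (fun y => H y j)) x)^2)) := by
  constructor
  · refine ⟨126 / 5, by norm_num, fun K A H Efn hK hA h => ?_⟩
    refine (h.integral_mul_curl_sq_le hΩ hK hA).trans ?_
    have hE0 : 0 ≤ ∫ x in Ω, ‖fderiv ℝ Efn x‖ ^ 2 := integral_nonneg fun x => by positivity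
    have hD0 : 0 ≤ ∫ x in Ω, (∑ i, ∑ j, (pdS i (fun y => H y j) x) ^ 2) ^ (3 : ℕ) :=
      integral_nonneg fun x => by positivity
    gcongr
    exact le_add_of_nonneg_left (by positivity)
  · intro η hη K hK
    refine ⟨126 / 5 * K + 1, by positivity, fun A H Efn hA h => ?_⟩
    refine (h.integral_mul_curl_sq_le hΩ hK hA).trans ?_
    have hE0 : 0 ≤ ∫ x in Ω, ‖fderiv ℝ Efn x‖ ^ 2 := integral_nonneg fun x => by positivity
    have hD0 : 0 ≤ ∫ x in Ω, ∑ i, ∑ j, (pdS i (fun y => H y j) x) ^ 2 :=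
      integral_nonneg fun x => by positivity
    have hQ0 : 0 ≤ ∫ x in Ω, ∑ k, ∑ i, ∑ j, (pdS k (pdS i (fun y => H y j)) x) ^ 2 :=
      integral_nonneg fun x => by positivity
    set D := ∫ x in Ω, ∑ i, ∑ j, (pdS i (fun y => H y j) x) ^ 2
    set Q := ∫ x in Ω, ∑ k, ∑ i, ∑ j, (pdS k (pdS i (fun y => H y j)) x) ^ 2
    have hsq : (Q ^ ((1 : ℝ) / 2)) ^ 2 = Q := by
      rw [← Real.sqrt_eq_rpow, Real.sq_sqrt hQ0]
    have hAQ : A * Q ^ ((1 : ℝ) / 2) ≤ A ^ 2 + D + Q := by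
      nlinarith [sq_nonneg (A - Q ^ ((1 : ℝ) / 2)), sq_nonneg A]
    calc 126 / 5 * K * (A * Q ^ ((1 : ℝ) / 2)) ≤ (126 / 5 * K + 1) * (A ^ 2 + D + Q) := by
          refine mul_le_mul (by linarith) hAQ ?_ (by positivity)
          positivity
      _ ≤ _ := le_add_of_nonneg_left (by positivity)
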